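/- arXiv:2508.19455 — 4 statements merged into one kernel-verified Lean document; each statement's English description precedes it below -/
import Mathlib

section
/- Fix N ≥ 1, twice continuously differentiable functions H₁, …, H_{N−1}, S : ℝᴺ → ℝ, and define the full NNET velocity field v : ℝᴺ → ℝᴺ by v(x) = w(x) + ∇S(x), where wᵢ(x) is the determinant of the N×N matrix whose first row is the i-th standard basis vector eᵢ and whose (k+1)-th row is ∇H_k(x) for k = 1, …, N−1. Then the divergence of v equals the Laplacian of the entropy: ∑ᵢ ∂vᵢ/∂xᵢ(x) = ∑ᵢ ∂²S/∂xᵢ²(x) for all x ∈ ℝᴺ; i.e., all compressibility of the NNET flow comes from the entropy term alone. -/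
/-- The gradient of `f` at `x`: the vector of partial derivatives. -/
noncomputable def grad {n : ℕ} (f : (Fin n → ℝ) → ℝ) (x : Fin n → ℝ) : Fin n → ℝ :=
  fun i => fderiv ℝ f x (Pi.single i 1)

/-- The divergence of a vector field `v` at `x`: `∑ i, ∂vᵢ/∂xᵢ (x)`. -/
noncomputable def diverg {n : ℕ} (v : (Fin n → ℝ) → (Fin n → ℝ)) (x : Fin n → ℝ) : ℝ :=
  ∑ i, fderiv ℝ (fun y => v y i) x (Pi.single i 1)

/-- The Laplacian of `f` at `x`: `∑ i, ∂²f/∂xᵢ² (x)`. -/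
noncomputable def laplacian {n : ℕ} (f : (Fin n → ℝ) → ℝ) (x : Fin n → ℝ) : ℝ :=
  ∑ i, fderiv ℝ (fun y => fderiv ℝ f y (Pi.single i 1)) x (Pi.single i 1)

/-- The incompressible (Nambu-bracket) part of the NNET velocity field in dimension
`N = n + 1 ≥ 1`: `wᵢ(x)` is the determinant of the `N × N` matrix whose first row is the
standard basis vector `eᵢ` and whose `(k+1)`-th row is `∇H_k(x)`. -/
noncomputable def nambuField {n : ℕ} (H : Fin n → (Fin (n + 1) → ℝ) → ℝ)
    (x : Fin (n + 1) → ℝ) : Fin (n + 1) → ℝ :=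
  fun i => Matrix.det (Matrix.of (Fin.cons (Pi.single i 1) (fun k => grad (H k) x)))

/-- The determinant as a continuous multilinear map of the rows. -/
noncomputable def detRowContinuousMultilinear (m : ℕ) :
    ContinuousMultilinearMap ℝ (fun _ : Fin m => Fin m → ℝ) ℝ where
  toMultilinearMap := (Matrix.detRowAlternating (n := Fin m) (R := ℝ)).toMultilinearMap
  cont := Continuous.matrix_det (A := fun M : Matrix (Fin m) (Fin m) ℝ => M) continuous_id

/-- Exchanging the first argument of an alternating map with a later one changes the sign. -/
theorem AlternatingMap.map_cons_update_swap {R M P : Type*} [CommRing R] [AddCommGroup M]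
    [Module R M] [AddCommGroup P] [Module R P] {n : ℕ} (f : M [⋀^Fin (n + 1)]→ₗ[R] P)
    (p : Fin n → M) (k : Fin n) (a b : M) :
    f (Fin.cons a (Function.update p k b)) = -f (Fin.cons b (Function.update p k a)) := by
  rw [← f.map_swap _ (Fin.succ_ne_zero k).symm]
  congr 1
  ext j
  cases j using Fin.cases with
  | zero => simp
  | succ j =>
    by_cases h : j = k
    · subst h; simp [-Fin.cons_update]
    · have h' : j.succ ≠ k.succ := fun e => h (Fin.succ_injective _ e)
      simp [Equiv.swap_apply_of_ne_of_ne (Fin.succ_ne_zero j) h', h]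

/-- Contracting two arguments of an alternating form against a symmetric matrix gives zero. -/
theorem AlternatingMap.sum_cons_update_eq_zero {n m : ℕ}
    (f : (Fin m → ℝ) [⋀^Fin (n + 1)]→ₗ[ℝ] ℝ) (p : Fin n → Fin m → ℝ) (k : Fin n)
    (B : Fin m → Fin m → ℝ) (hB : ∀ i j, B i j = B j i) :
    ∑ i, f (Fin.cons (Pi.single i 1) (Function.update p k (B i))) = 0 := by
  have expand : ∀ i, f (Fin.cons (Pi.single i 1) (Function.update p k (B i))) =
      ∑ j, B i j * f (Fin.cons (Pi.single i 1) (Function.update p k (Pi.single j 1))) := by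
    intro i
    conv_lhs => rw [pi_eq_sum_univ' (B i), Fin.cons_update, f.map_update_sum]
    refine Finset.sum_congr rfl fun j _ => ?_
    rw [f.map_update_smul, ← Fin.cons_update, smul_eq_mul]
  simp_rw [expand]
  have antisymm : ∑ i, ∑ j, B i j *
        f (Fin.cons (Pi.single i 1) (Function.update p k (Pi.single j 1))) =
      -∑ i, ∑ j, B i j *
        f (Fin.cons (Pi.single i 1) (Function.update p k (Pi.single j 1))) := by
    conv_lhs => rw [Finset.sum_comm]
    simp_rw [← Finset.sum_neg_distrib]
    refine Finset.sum_congr rfl fun i _ => Finset.sum_congr rfl fun j _ => ?_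
    rw [hB j i, f.map_cons_update_swap p k (Pi.single j 1), mul_neg]
  linarith

theorem ContDiff.hasFDerivAt_fderiv_apply {n : ℕ} {f : (Fin n → ℝ) → ℝ} (hf : ContDiff ℝ 2 f)
    (x u : Fin n → ℝ) :
    HasFDerivAt (fun y => fderiv ℝ f y u) ((fderiv ℝ (fderiv ℝ f) x).flip u) x := by
  have h : DifferentiableAt ℝ (fderiv ℝ f) x :=
    (hf.fderiv_right (m := 1) (by norm_num)).differentiable (by norm_num) x
  simpa using h.hasFDerivAt.clm_apply (hasFDerivAt_const u x)

theorem ContDiff.hasFDerivAt_grad {n : ℕ} {f : (Fin n → ℝ) → ℝ} (hf : ContDiff ℝ 2 f)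
    (x : Fin n → ℝ) :
    HasFDerivAt (grad f)
      (ContinuousLinearMap.pi fun i => (fderiv ℝ (fderiv ℝ f) x).flip (Pi.single i 1)) x :=
  hasFDerivAt_pi.2 fun i => hf.hasFDerivAt_fderiv_apply x (Pi.single i 1)

/-- The product rule for the components of the Nambu field. -/
theorem hasFDerivAt_nambuField {n : ℕ} {H : Fin n → (Fin (n + 1) → ℝ) → ℝ}
    (hH : ∀ k, ContDiff ℝ 2 (H k)) (x : Fin (n + 1) → ℝ) (i : Fin (n + 1)) :
    ∃ L : (Fin (n + 1) → ℝ) →L[ℝ] ℝ, HasFDerivAt (fun y => nambuField H y i) L x ∧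
      ∀ u, L u = ∑ k, Matrix.detRowAlternating (Fin.cons (Pi.single i 1)
        (Function.update (fun k => grad (H k) x) k
          (fun j => fderiv ℝ (fderiv ℝ (H k)) x u (Pi.single j 1)))) := by
  have rows : ∀ r : Fin (n + 1), HasFDerivAt
      (fun y => (Fin.cons (Pi.single i 1) (fun k => grad (H k) y) :
        Fin (n + 1) → Fin (n + 1) → ℝ) r)
      ((Fin.cons 0 fun k => ContinuousLinearMap.pi fun j =>
        (fderiv ℝ (fderiv ℝ (H k)) x).flip (Pi.single j 1) :
        Fin (n + 1) → (Fin (n + 1) → ℝ) →L[ℝ] (Fin (n + 1) → ℝ)) r) x := by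
    intro r
    cases r using Fin.cases with
    | zero => exact hasFDerivAt_const (Pi.single i 1 : Fin (n + 1) → ℝ) x
    | succ k => exact (hH k).hasFDerivAt_grad x
  refine ⟨_, HasFDerivAt.multilinear_comp (f := detRowContinuousMultilinear (n + 1)) rows,
    fun u => ?_⟩
  rw [Fin.sum_univ_succ, add_apply, sum_apply, Fin.cons_zero, ContinuousLinearMap.comp_zero,
    zero_apply, zero_add]
  refine Finset.sum_congr rfl fun k _ => ?_
  rw [Fin.cons_update]
  rfl

/-- The Nambu field is divergence free. -/
theorem diverg_nambuField {n : ℕ} {H : Fin n → (Fin (n + 1) → ℝ) → ℝ}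
    (hH : ∀ k, ContDiff ℝ 2 (H k)) (x : Fin (n + 1) → ℝ) :
    diverg (nambuField H) x = 0 := by
  choose L hL hLu using hasFDerivAt_nambuField hH x
  simp only [diverg, (hL _).fderiv, hLu]
  rw [Finset.sum_comm]
  refine Finset.sum_eq_zero fun k _ => ?_
  exact AlternatingMap.sum_cons_update_eq_zero _ _ k
    (fun i j => fderiv ℝ (fderiv ℝ (H k)) x (Pi.single i 1) (Pi.single j 1))
    fun i j => (hH k).contDiffAt.isSymmSndFDerivAt (by simp) _ _

/-- The divergence of the full NNET velocity field `v(x) = w(x) + ∇S(x)` equals the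
Laplacian of the entropy: all compressibility comes from the entropy term alone. -/
theorem nnet_divergence_eq_entropy_laplacian
    (n : ℕ) (H : Fin n → (Fin (n + 1) → ℝ) → ℝ) (S : (Fin (n + 1) → ℝ) → ℝ)
    (hH : ∀ k, ContDiff ℝ 2 (H k)) (hS : ContDiff ℝ 2 S) :
    ∀ x : Fin (n + 1) → ℝ,
      diverg (fun y => nambuField H y + grad S y) x = laplacian S x := by
  intro x
  have hadd : diverg (fun y => nambuField H y + grad S y) x =
      diverg (nambuField H) x + diverg (grad S) x := by
    simp only [diverg, ← Finset.sum_add_distrib]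
    refine Finset.sum_congr rfl fun i _ => ?_
    obtain ⟨L, hL, -⟩ := hasFDerivAt_nambuField hH x i
    have hG : HasFDerivAt (fun y => grad S y i) _ x :=
      hS.hasFDerivAt_fderiv_apply x (Pi.single i 1)
    have hsum : HasFDerivAt (fun y => (nambuField H y + grad S y) i) _ x := hL.add hG
    rw [hsum.fderiv, hL.fderiv, hG.fderiv, add_apply]
  rw [hadd, diverg_nambuField hH x, zero_add]
  rfl
end

section
/- Let k̃₁₂, k̃₂₃, k̃₃₁ ∈ ℝ, k_Σ = k̃₁₂ + k̃₂₃ + k̃₃₁, define the triangular chemical reaction vector field V : ℝ³ → ℝ³ by V(x₁,x₂,x₃) = (−k̃₁₂x₁ + k̃₃₁x₃, k̃₁₂x₁ − k̃₂₃x₂, k̃₂₃x₂ − k̃₃₁x₃), and define the entropy S(x₁,x₂,x₃) = −(k_Σ/4)(x₁ − x₂)². Then the Helmholtz decomposition V = (V − ∇S) + ∇S splits V into an incompressible part and a gradient part: the vector field x ↦ V(x) − ∇S(x) has identically vanishing divergence, while ∑ᵢ ∂²S/∂xᵢ²(x) = −k_Σ = ∑ᵢ ∂Vᵢ/∂xᵢ(x)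 for all x. -/
/-- The triangular chemical reaction vector field. -/
noncomputable def triangularField (k12 k23 k31 : ℝ) (x : Fin 3 → ℝ) : Fin 3 → ℝ :=
  ![-k12 * x 0 + k31 * x 2, k12 * x 0 - k23 * x 1, k23 * x 1 - k31 * x 2]

theorem fderiv_single_eq_of_eq_sum {n : ℕ} {f : (Fin n → ℝ) → ℝ} {a : Fin n → ℝ}
    (hf : ∀ y, f y = ∑ j, a j * y j) (x : Fin n → ℝ) (i : Fin n) :
    fderiv ℝ f x (Pi.single i 1) = a i := by
  have h : f = ⇑(∑ j, a j • ContinuousLinearMap.proj (R := ℝ) (φ := fun _ : Fin n => ℝ) j) := by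
    ext y
    simp [hf]
  rw [h, ContinuousLinearMap.fderiv]
  simp [Pi.single_apply]

theorem diverg_eq_trace {n : ℕ} {v : (Fin n → ℝ) → (Fin n → ℝ)} {A : Matrix (Fin n) (Fin n) ℝ}
    (hv : ∀ y, v y = A.mulVec y) (x : Fin n → ℝ) : diverg v x = A.trace :=
  Finset.sum_congr rfl fun i _ => fderiv_single_eq_of_eq_sum (a := A i)
    (fun y => by rw [hv]; rfl) x i

theorem grad_const_mul_sq_sub (c : ℝ) (x : Fin 3 → ℝ) :
    grad (fun y : Fin 3 → ℝ => c * (y 0 - y 1) ^ 2) x =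
      !![2 * c, -(2 * c), 0; -(2 * c), 2 * c, 0; 0, 0, 0].mulVec x := by
  have h (j : Fin 3) : HasFDerivAt (fun y : Fin 3 → ℝ => y j)
      (ContinuousLinearMap.proj (R := ℝ) (φ := fun _ : Fin 3 => ℝ) j) x := hasFDerivAt_apply j x
  have hsq : HasFDerivAt (fun y : Fin 3 → ℝ => c * (y 0 - y 1) ^ 2) _ x :=
    (((h 0).sub (h 1)).pow 2).const_mul c
  ext i
  rw [grad, hsq.fderiv]
  fin_cases i <;> simp [Matrix.mulVec, dotProduct, Fin.sum_univ_three] <;> ring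

theorem triangularField_eq_mulVec (k12 k23 k31 : ℝ) (x : Fin 3 → ℝ) :
    triangularField k12 k23 k31 x =
      !![-k12, 0, k31; k12, -k23, 0; 0, k23, -k31].mulVec x := by
  ext i
  fin_cases i <;>
    simp [triangularField, Matrix.mulVec, dotProduct, Fin.sum_univ_three, sub_eq_add_neg]

/-- Helmholtz decomposition of the triangular reaction flow with entropy
`S = −(k_Σ/4)(x₁ − x₂)²`: the field `V − ∇S` is divergence-free, while
`ΔS = −k_Σ = div V` everywhere. -/
theorem triangular_reaction_helmholtz_decomposition
    (k12 k23 k31 : ℝ) (kSigma : ℝ) (hkSigma : kSigma = k12 + k23 + k31)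
    (S : (Fin 3 → ℝ) → ℝ) (hSdef : S = fun x => -(kSigma / 4) * (x 0 - x 1) ^ 2) :
    (∀ x : Fin 3 → ℝ, diverg (fun y => triangularField k12 k23 k31 y - grad S y) x = 0) ∧
    (∀ x : Fin 3 → ℝ, laplacian S x = -kSigma) ∧
    (∀ x : Fin 3 → ℝ, diverg (triangularField k12 k23 k31) x = -kSigma) := by
  subst hSdef
  refine ⟨fun x => ?_, fun x => ?_, fun x => ?_⟩
  · rw [diverg_eq_trace (fun y => by
      rw [triangularField_eq_mulVec, grad_const_mul_sq_sub, ← Matrix.sub_mulVec])]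
    simp [Matrix.trace_fin_three]
    linarith
  · change diverg (grad _) x = _
    rw [diverg_eq_trace (grad_const_mul_sq_sub _)]
    simp [Matrix.trace_fin_three]
    ring
  · rw [diverg_eq_trace (triangularField_eq_mulVec k12 k23 k31)]
    simp [Matrix.trace_fin_three]
    linarith
end

section
/- Let k̃₁₂, k̃₂₃, k̃₃₁ ∈ ℝ and define the triangular chemical reaction vector field V : ℝ³ → ℝ³ by V(x₁,x₂,x₃) = (−k̃₁₂x₁ + k̃₃₁x₃, k̃₁₂x₁ − k̃₂₃x₂, k̃₂₃x₂ − k̃₃₁x₃). Define H₁(x) = ¼(x₁² + x₂² + x₃²), H₂(x) = k̃₂₃x₁ + k̃₃₁x₂ + k̃₁₂x₃, and S(x) = −½[ k̃₁₂(x₁² − x₁x₂) + k̃₂₃(x₂² − x₂x₃) + k̃₃₁(x₃² − x₃x₁) ]. Then for every x ∈ ℝ³, V(x) = ∇H₂(x) × ∇H₁(x) + ∇S(x); i.e., the triangular reaction is exactly a Nambu non-equilibrium thermodynamic system with Hamiltonians H₁, H₂ and entropy S. -/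
theorem HasFDerivAt.grad_eq {n : ℕ} {f : (Fin n → ℝ) → ℝ} {f' : (Fin n → ℝ) →L[ℝ] ℝ}
    {x : Fin n → ℝ} (h : HasFDerivAt f f' x) : grad f x = fun i => f' (Pi.single i 1) := by
  funext i
  rw [grad, h.fderiv]

/-- The triangular chemical reaction is exactly a Nambu non-equilibrium thermodynamic
system: with `H₁ = ¼(x₁² + x₂² + x₃²)`, `H₂ = k̃₂₃x₁ + k̃₃₁x₂ + k̃₁₂x₃` and
`S = −½[k̃₁₂(x₁² − x₁x₂) + k̃₂₃(x₂² − x₂x₃) + k̃₃₁(x₃² − x₃x₁)]`, one has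
`V(x) = ∇H₂(x) × ∇H₁(x) + ∇S(x)` for every `x`. -/
theorem triangular_reaction_is_nnet
    (k12 k23 k31 : ℝ)
    (H₁ H₂ S : (Fin 3 → ℝ) → ℝ)
    (hH₁ : H₁ = fun x => (1 / 4) * ((x 0) ^ 2 + (x 1) ^ 2 + (x 2) ^ 2))
    (hH₂ : H₂ = fun x => k23 * x 0 + k31 * x 1 + k12 * x 2)
    (hS : S = fun x => -(1 / 2) * (k12 * ((x 0) ^ 2 - x 0 * x 1)
      + k23 * ((x 1) ^ 2 - x 1 * x 2) + k31 * ((x 2) ^ 2 - x 2 * x 0))) :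
    ∀ x : Fin 3 → ℝ,
      triangularField k12 k23 k31 x = crossProduct (grad H₂ x) (grad H₁ x) + grad S x := by
  intro x
  have coord (i : Fin 3) : HasFDerivAt (fun y : Fin 3 → ℝ => y i)
      (ContinuousLinearMap.proj (R := ℝ) i) x := hasFDerivAt_apply i x
  have gH₁ : grad H₁ x = ![x 0 / 2, x 1 / 2, x 2 / 2] := by
    rw [hH₁]
    refine (((((coord 0).pow 2).add ((coord 1).pow 2)).add
      ((coord 2).pow 2)).const_mul (1 / 4)).grad_eq.trans ?_
    ext i
    fin_cases i <;> simp <;> ring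
  have gH₂ : grad H₂ x = ![k23, k31, k12] := by
    rw [hH₂]
    refine ((((coord 0).const_mul k23).add ((coord 1).const_mul k31)).add
      ((coord 2).const_mul k12)).grad_eq.trans ?_
    ext i
    fin_cases i <;> simp
  have gS : grad S x = ![-k12 * x 0 + k12 * x 1 / 2 + k31 * x 2 / 2,
      -k23 * x 1 + k23 * x 2 / 2 + k12 * x 0 / 2,
      -k31 * x 2 + k31 * x 0 / 2 + k23 * x 1 / 2] := by
    have edge (i j : Fin 3) (k : ℝ) :=
      (((coord i).pow 2).sub ((coord i).mul (coord j))).const_mul k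
    rw [hS]
    refine ((((edge 0 1 k12).add (edge 1 2 k23)).add (edge 2 0 k31)).const_mul
      (-(1 / 2))).grad_eq.trans ?_
    ext i
    fin_cases i <;> simp <;> ring
  rw [gH₁, gH₂, gS, cross_apply]
  ext i
  fin_cases i <;> simp [triangularField] <;> ring
end

section
/- Let A be a real 3×3 matrix with entries a_{ij}, viewed as the linear vector field V(x) = Ax on ℝ³. Define ω = ½(a₃₂ − a₂₃, a₁₃ − a₃₁, a₂₁ − a₁₂) ∈ ℝ³, H₁(x) = ⟨ω, x⟩, H₂(x) = ½‖x‖², and S(x) = ¼⟨x, (A + Aᵀ)x⟩. Then for every x ∈ ℝ³, Ax = ∇H₁(x) × ∇H₂(x) + ∇S(x). Hence the existence proposition of NNET holds for every linear autonomous system on ℝ³: it is exactly a Nambu non-equilibrium thermodynamic system with Hamiltonians H₁, H₂ and entropy S. -/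
open Matrix

/-- The gradient of the linear form `x ↦ ⟨w, x⟩` is `w`. -/
lemma grad_linear {n : ℕ} (w x : Fin n → ℝ) : grad (fun x => ∑ i, w i * x i) x = w := by
  ext j
  have h : HasFDerivAt (fun x : Fin n → ℝ => ∑ i, w i * x i)
      (∑ i, w i • ContinuousLinearMap.proj (R := ℝ) (φ := fun _ : Fin n => ℝ) i) x :=
    HasFDerivAt.fun_sum fun i _ => (hasFDerivAt_apply i x).const_mul (w i)
  simp [grad, h.fderiv, Pi.single_apply]

/-- The gradient of the quadratic form `x ↦ c ⟨x, M x⟩` is `c (M + Mᵀ) x`. -/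
lemma grad_quadratic {n : ℕ} (c : ℝ) (M : Matrix (Fin n) (Fin n) ℝ) (x : Fin n → ℝ) :
    grad (fun x => c * ∑ i, x i * M.mulVec x i) x = c • (M + Mᵀ).mulVec x := by
  ext j
  have h : HasFDerivAt (fun x : Fin n → ℝ => c * ∑ i, x i * M.mulVec x i)
      (c • ∑ i, (x i • (∑ k, M i k • ContinuousLinearMap.proj (R := ℝ) (φ := fun _ : Fin n => ℝ) k)
        + M.mulVec x i • ContinuousLinearMap.proj (R := ℝ) (φ := fun _ : Fin n => ℝ) i)) x := by
    refine HasFDerivAt.const_mul (HasFDerivAt.fun_sum fun i _ => ?_) c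
    have hM : HasFDerivAt (fun x : Fin n → ℝ => M.mulVec x i)
        (∑ k, M i k • ContinuousLinearMap.proj (R := ℝ) (φ := fun _ : Fin n => ℝ) k) x := by
      unfold mulVec dotProduct
      exact HasFDerivAt.fun_sum fun k _ => (hasFDerivAt_apply k x).const_mul (M i k)
    exact (hasFDerivAt_apply i x).mul hM
  rw [grad, h.fderiv]
  simp [Pi.single_apply, Finset.sum_add_distrib, add_mulVec, mulVec, dotProduct, mul_comm,
    add_comm, mul_add]

/-- The gradient of `x ↦ ½‖x‖²` is `x`. -/
lemma grad_half_sum_sq {n : ℕ} (x : Fin n → ℝ) :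
    grad (fun x => (1 / 2) * ∑ i, (x i) ^ 2) x = x := by
  have h := grad_quadratic (1 / 2) (1 : Matrix (Fin n) (Fin n) ℝ) x
  simp only [one_mulVec, ← pow_two, transpose_one, add_mulVec] at h
  rw [h]
  ext j
  simp only [Pi.smul_apply, Pi.add_apply, smul_eq_mul]
  ring

/-- Existence proposition of NNET for linear autonomous systems on `ℝ³`: for any real
`3 × 3` matrix `A`, with `ω = ½(a₃₂ − a₂₃, a₁₃ − a₃₁, a₂₁ − a₁₂)`, `H₁(x) = ⟨ω, x⟩`,
`H₂(x) = ½‖x‖²` and `S(x) = ¼⟨x, (A + Aᵀ)x⟩`, one has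
`Ax = ∇H₁(x) × ∇H₂(x) + ∇S(x)` for every `x`. -/
theorem linear_system_is_nnet
    (A : Matrix (Fin 3) (Fin 3) ℝ)
    (ω : Fin 3 → ℝ)
    (hω : ω = (1 / 2 : ℝ) • ![A 2 1 - A 1 2, A 0 2 - A 2 0, A 1 0 - A 0 1])
    (H₁ H₂ S : (Fin 3 → ℝ) → ℝ)
    (hH₁ : H₁ = fun x => ∑ i, ω i * x i)
    (hH₂ : H₂ = fun x => (1 / 2) * ∑ i, (x i) ^ 2)
    (hS : S = fun x => (1 / 4) * ∑ i, x i * ((A + Aᵀ).mulVec x i)) :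
    ∀ x : Fin 3 → ℝ,
      A.mulVec x = crossProduct (grad H₁ x) (grad H₂ x) + grad S x := by
  intro x
  rw [hH₁, hH₂, hS, grad_linear, grad_half_sum_sq, grad_quadratic, hω]
  ext i
  fin_cases i <;>
    simp [crossProduct, mulVec, dotProduct, Fin.sum_univ_three] <;> ring
end
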